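/- For every smooth function L on ℝ^{2n+1} and every smooth φ: ℝⁿ → ℝ, the pullback of E(Lβ) along the first prolongation of φ is the Euler–Lagrange expression of L: (j¹φ)*E(Lβ) = [ (∂L/∂u)(j¹φ(x)) − Σ_μ d/dx^μ( (∂L/∂p_μ)(j¹φ(x)) ) ] β. In particular, Δ_{E(Lβ)}φ = 0 holds if and only if φ satisfies the Euler–Lagrange equation of the first-order Lagrangian function L(x, φ(x), ∇φ(x)). -/

import Mathlib

noncomputable section

namespace MA

/-- Points / tangent vectors of ℝ^m. -/
abbrev Vec (m : ℕ) := Fin m → ℝ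

/-- An (unbundled) differential `k`-form on ℝ^m : at each point it eats a
`k`-tuple of tangent vectors and returns a real number. -/
abbrev Form (m k : ℕ) := Vec m → (Fin k → Vec m) → ℝ

/-- `ω` is pointwise an alternating multilinear map, i.e. a genuine exterior form. -/
def IsForm {m k : ℕ} (ω : Form m k) : Prop :=
  ∀ x : Vec m, ∃ a : AlternatingMap ℝ (Vec m) ℝ (Fin k), ∀ v, ω x v = a v

/-- Smoothness of a differential form (smoothness of all coefficients). -/
def SmoothForm {m k : ℕ} (ω : Form m k) : Prop :=
  ∀ v : Fin k → Vec m, ContDiff ℝ (⊤ : ℕ∞) fun x => ω x v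

/-- Multiplication of a form by a scalar function. -/
def fsmul {m k : ℕ} (f : Vec m → ℝ) (ω : Form m k) : Form m k := fun x v => f x * ω x v

/-- Wedge (exterior) product of differential forms. -/
def wedge {m k l : ℕ} (ω : Form m k) (η : Form m l) : Form m (k + l) := fun x v =>
  ((k.factorial * l.factorial : ℕ) : ℝ)⁻¹ *
    ∑ σ : Equiv.Perm (Fin (k + l)),
      ((Equiv.Perm.sign σ : ℤ) : ℝ) *
        (ω x fun i => v (σ (Fin.castAdd l i))) *
        (η x fun j => v (σ (Fin.natAdd k j)))

/-- Interior product (contraction) of a form with a (constant) vector. -/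
def iprod {m : ℕ} (u : Vec m) : ∀ {k : ℕ}, Form m k → Form m (k - 1)
  | 0, _ => 0
  | _ + 1, ω => fun x v => ω x (Fin.cons u v)

/-- Exterior derivative of a differential form (coordinate formula). -/
def exd {m k : ℕ} (ω : Form m k) : Form m (k + 1) := fun x v =>
  ∑ i : Fin (k + 1),
    (-1 : ℝ) ^ (i : ℕ) * fderiv ℝ (fun y => ω y fun j => v (i.succAbove j)) x (v i)

/-- Change the (propositionally equal) degree of a form. -/
def reindex {m k l : ℕ} (h : k = l) (ω : Form m k) : Form m l :=
  fun x v => ω x fun i => v (Fin.cast h i)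

/-- Pullback of a differential form along a map. -/
def pullback {a b k : ℕ} (f : Vec a → Vec b) (ω : Form b k) : Form a k :=
  fun x v => ω (f x) fun i => fderiv ℝ f x (v i)

/-- `i`-th standard basis vector of ℝ^m. -/
def basisVec {m : ℕ} (i : Fin m) : Vec m := Pi.single i 1

/-- The coordinate 1-form `dx^i`. -/
def dx {m : ℕ} (i : Fin m) : Form m 1 := fun _ v => v 0 i

/-- Partial derivative of a function in the `i`-th coordinate direction. -/
def pd {m : ℕ} (i : Fin m) (f : Vec m → ℝ) : Vec m → ℝ := fun x => fderiv ℝ f x (basisVec i)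

/- Jet-space coordinates on J¹ℝⁿ = ℝ^{2n+1} : (q¹,…,qⁿ,u,p₁,…,pₙ). -/

/-- Index of the coordinate `q^μ`. -/
def qIdx {n : ℕ} (μ : Fin n) : Fin (2 * n + 1) := ⟨μ, by have := μ.isLt; omega⟩

/-- Index of the coordinate `u`. -/
def uIdx {n : ℕ} : Fin (2 * n + 1) := ⟨n, by omega⟩

/-- Index of the coordinate `p_μ`. -/
def pIdx {n : ℕ} (μ : Fin n) : Fin (2 * n + 1) := ⟨n + 1 + μ, by have := μ.isLt; omega⟩

/-- The Reeb field `χ = ∂/∂u` (a constant vector field). -/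
def chi {n : ℕ} : Vec (2 * n + 1) := basisVec uIdx

/-- The standard contact form `c = du - Σ p_μ dq^μ` on J¹ℝⁿ. -/
def contact {n : ℕ} : Form (2 * n + 1) 1 := fun x v =>
  v 0 uIdx - ∑ μ : Fin n, x (pIdx μ) * v 0 (qIdx μ)

/-- The symplectic-type 2-form `Ω = dc = Σ dq^μ ∧ dp_μ`. -/
def symp {n : ℕ} : Form (2 * n + 1) 2 := ∑ μ : Fin n, wedge (dx (qIdx μ)) (dx (pIdx μ))

/-- The bottom operator `⊥ = Σ_μ ∂_{p_μ} ⌟ ∂_{q^μ} ⌟ ·` (zero on forms of degree ≤ 1). -/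
def botOp {n k : ℕ} (ω : Form (2 * n + 1) k) : Form (2 * n + 1) (k - 2) :=
  ∑ μ : Fin n, iprod (basisVec (pIdx μ)) (iprod (basisVec (qIdx μ)) ω)

/-- A form is effective if it is killed by `χ ⌟ ·` and by `⊥`. -/
def Effective {n k : ℕ} (ω : Form (2 * n + 1) k) : Prop :=
  iprod (chi (n := n)) ω = 0 ∧ botOp ω = 0

/-- The projection `p(α) = α - c ∧ (χ ⌟ α)` onto forms annihilated by `χ ⌟ ·`. -/
def proj {n : ℕ} : ∀ {k : ℕ}, Form (2 * n + 1) k → Form (2 * n + 1) k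
  | 0, α => α
  | j + 1, α => α - reindex (Nat.add_comm 1 j) (wedge contact (iprod (chi (n := n)) α))

/-- The projected exterior derivative `d_p = p ∘ d`. -/
def dproj {n k : ℕ} (ω : Form (2 * n + 1) k) : Form (2 * n + 1) (k + 1) := proj (exd ω)

/-- Lie derivative along the (constant) Reeb field `χ`. -/
def lieChi {n k : ℕ} (ω : Form (2 * n + 1) k) : Form (2 * n + 1) k := fun x v =>
  fderiv ℝ (fun y => ω y v) x (chi (n := n))

/-- The Euler operator `E = d_p ∘ ⊥ ∘ d_p + L_χ` on n-forms over J¹ℝⁿ. -/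
def euler : ∀ {n : ℕ}, Form (2 * n + 1) n → Form (2 * n + 1) n
  | 0, ω => lieChi ω
  | n + 1, ω =>
    reindex (show n + 1 + 1 - 2 + 1 = n + 1 by omega) (dproj (botOp (dproj ω))) + lieChi ω

/-- The horizontal volume form `β = dq¹ ∧ … ∧ dqⁿ` on J¹ℝⁿ. -/
def qvol {n : ℕ} : Form (2 * n + 1) n := fun _ v =>
  Matrix.det (Matrix.of fun i j : Fin n => v i (qIdx j))

/-- The volume form `β = dq¹ ∧ … ∧ dqⁿ` on the base ℝⁿ. -/
def baseVol {n : ℕ} : Form n n := fun _ v => Matrix.det (Matrix.of fun i j : Fin n => v i j)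

/-- `β_μ = ∂_{q^μ} ⌟ β`. -/
def betaMu {n : ℕ} (μ : Fin n) : Form (2 * n + 1) (n - 1) := iprod (basisVec (qIdx μ)) qvol

/-- The first jet prolongation `j¹φ : ℝⁿ → ℝ^{2n+1}`, `x ↦ (x, φ(x), ∂₁φ(x), …, ∂ₙφ(x))`. -/
def jet {n : ℕ} (φ : Vec n → ℝ) (x : Vec n) : Vec (2 * n + 1) := fun i =>
  if h : (i : ℕ) < n then x ⟨i, h⟩
  else if h2 : (i : ℕ) = n then φ x
  else fderiv ℝ φ x (basisVec ⟨(i : ℕ) - (n + 1), by have := i.isLt; omega⟩)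

/-- Second partial derivative `φ_{μν} = ∂²φ/∂q^μ∂q^ν`. -/
def d2 {n : ℕ} (φ : Vec n → ℝ) (μ ν : Fin n) : Vec n → ℝ := fun x =>
  fderiv ℝ (fun y => fderiv ℝ φ y (basisVec ν)) x (basisVec μ)

/-- A form is multisymplectic if it is closed and pointwise nondegenerate. -/
def Multisymplectic {m k : ℕ} (μ : Form m k) : Prop :=
  exd μ = 0 ∧ ∀ (x v : Vec m), iprod v μ x = 0 → v = 0

/-- Lift a form on J¹ℝⁿ = ℝ^{2n+1} to ℝ^{2n+2} = J¹ℝⁿ × ℝ (extra coordinate `e`)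
along the projection. -/
def liftForm {n k : ℕ} (ω : Form (2 * n + 1) k) : Form (2 * n + 1 + 1) k :=
  pullback (fun y (i : Fin (2 * n + 1)) => y i.castSucc) ω

/-- The 1-form `de` on ℝ^{2n+2}. -/
def deForm {n : ℕ} : Form (2 * n + 1 + 1) 1 := dx (Fin.last (2 * n + 1))

/-- The (n+1)-form `m_ω = de ∧ β + c ∧ ω` on ℝ^{2n+2}. -/
def msf {n : ℕ} (ω : Form (2 * n + 1) n) : Form (2 * n + 1 + 1) (n + 1) :=
  reindex (Nat.add_comm 1 n) (wedge (deForm (n := n)) (liftForm qvol)) +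
    reindex (Nat.add_comm 1 n) (wedge (liftForm (contact (n := n))) (liftForm ω))

/-- Contracting `ℓ ∧ det` with `u` gives zero, so `ℓ ∧ (u ⌟ det) = ℓ u • det`. -/
lemma sum_mul_det_cons {n : ℕ} (l : Vec (n + 1) →ₗ[ℝ] ℝ) (u : Vec (n + 1))
    (v : Fin (n + 1) → Vec (n + 1)) :
    ∑ i : Fin (n + 1), (-1 : ℝ) ^ (i : ℕ) * (l (v i) *
      Matrix.det (Matrix.of (Fin.cons u (fun j => v (i.succAbove j)) : Fin (n + 1) → _))) =
      l u * Matrix.det (Matrix.of v) := by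
  let w : Fin (n + 2) → Vec (n + 1) := Fin.cons u v
  let M : Matrix (Fin (n + 2)) (Fin (n + 2)) ℝ :=
    Matrix.of fun i => (Fin.cons (l (w i)) (w i) : Fin (n + 2) → ℝ)
  have hM : M.det = 0 := by
    refine Matrix.exists_mulVec_eq_zero_iff.mp
      ⟨Fin.cons (-1) (fun j => l (Pi.single j 1)), fun h => ?_, ?_⟩
    · simpa using congrFun h 0
    · ext i
      have := LinearMap.pi_apply_eq_sum_univ l (w i)
      simp only [smul_eq_mul] at this
      simp only [M, Matrix.mulVec, dotProduct, Matrix.of_apply, Fin.sum_univ_succ, Fin.cons_zero,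
        Fin.cons_succ, Pi.zero_apply]
      rw [Fin.sum_univ_succ] at this
      have e : ∀ i : Fin (n + 1), (fun j => if i = j then (1 : ℝ) else 0) = Pi.single i 1 := by
        intro i
        ext j
        simp [Pi.single_apply, eq_comm]
      simp only [e] at this
      linarith
  rw [Matrix.det_succ_column_zero, Fin.sum_univ_succ] at hM
  have h0 : M.submatrix (Fin.succAbove 0) Fin.succ = Matrix.of v := by
    ext i j
    simp [M, w]
  have hs : ∀ k : Fin (n + 1), M.submatrix k.succ.succAbove Fin.succ =
      Matrix.of (Fin.cons u (fun j => v (k.succAbove j)) : Fin (n + 1) → _) := by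
    intro k
    ext i j
    cases i using Fin.cases <;> simp [M, w]
  have e0 : M 0 0 = l u := rfl
  have es : ∀ k : Fin (n + 1), M k.succ 0 = l (v k) := fun _ => rfl
  simp only [h0, hs, e0, es, Fin.val_zero, Fin.val_succ, pow_succ, pow_zero, one_mul, mul_neg,
    mul_one, neg_mul, Finset.sum_neg_distrib] at hM
  simp only [mul_assoc] at hM
  linarith

lemma qvol_eq_zero {n : ℕ} (x : Vec (2 * n + 1)) (v : Fin n → Vec (2 * n + 1)) (i : Fin n)
    (h : ∀ μ : Fin n, v i (qIdx μ) = 0) : qvol x v = 0 :=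
  Matrix.det_eq_zero_of_row_eq_zero i h

lemma basisVec_pIdx_qIdx {n : ℕ} (μ ν : Fin n) :
    (basisVec (pIdx μ) : Vec (2 * n + 1)) (qIdx ν) = 0 :=
  Pi.single_eq_of_ne (by simp only [pIdx, qIdx, ne_eq, Fin.mk.injEq]; omega) _

lemma basisVec_pIdx_uIdx {n : ℕ} (μ : Fin n) :
    (basisVec (pIdx μ) : Vec (2 * n + 1)) uIdx = 0 :=
  Pi.single_eq_of_ne (by simp only [pIdx, uIdx, ne_eq, Fin.mk.injEq]; omega) _

lemma chi_qIdx {n : ℕ} (ν : Fin n) : (chi : Vec (2 * n + 1)) (qIdx ν) = 0 :=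
  Pi.single_eq_of_ne (by simp only [uIdx, qIdx, ne_eq, Fin.mk.injEq]; omega) _

lemma basisVec_qIdx_qIdx {n : ℕ} (μ ν : Fin n) :
    (basisVec (qIdx μ) : Vec (2 * n + 1)) (qIdx ν) = basisVec μ ν := by
  simp [basisVec, Pi.single_apply, qIdx, Fin.ext_iff]

lemma exd_fsmul_qvol {n : ℕ} {L : Vec (2 * n + 1) → ℝ} (hL : Differentiable ℝ L)
    (x : Vec (2 * n + 1)) (v : Fin (n + 1) → Vec (2 * n + 1)) :
    exd (fsmul L qvol) x v =
      ∑ i : Fin (n + 1), (-1 : ℝ) ^ (i : ℕ) *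
        (fderiv ℝ L x (v i) * qvol x fun j => v (i.succAbove j)) := by
  refine Finset.sum_congr rfl fun i _ => ?_
  have : (fun y => fsmul L qvol y fun j => v (i.succAbove j)) =
      fun y => L y * qvol x fun j => v (i.succAbove j) := rfl
  rw [this, fderiv_mul_const (hL x)]
  simp [mul_comm]

/-- `d(Lβ)` vanishes on tuples containing two vectors that are vertical over `ℝⁿ`. -/
lemma exd_fsmul_qvol_eq_zero {n : ℕ} {L : Vec (2 * n + 1) → ℝ} (hL : Differentiable ℝ L)
    (x : Vec (2 * n + 1)) (v : Fin (n + 1) → Vec (2 * n + 1)) {a b : Fin (n + 1)} (hab : a ≠ b)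
    (ha : ∀ μ : Fin n, v a (qIdx μ) = 0) (hb : ∀ μ : Fin n, v b (qIdx μ) = 0) :
    exd (fsmul L qvol) x v = 0 := by
  rw [exd_fsmul_qvol hL]
  refine Finset.sum_eq_zero fun i _ => ?_
  have key : ∀ c, c ≠ i → (∀ μ : Fin n, v c (qIdx μ) = 0) →
      (qvol x fun j => v (i.succAbove j)) = 0 := by
    intro c hc h
    obtain ⟨j, rfl⟩ := Fin.exists_succAbove_eq hc
    exact qvol_eq_zero _ _ j h
  by_cases hi : a = i
  · rw [key b (by rintro rfl; exact hab hi) hb]; simp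
  · rw [key a hi ha]; simp

/-- On tuples containing some `∂_{p_μ}`, projecting `d(Lβ)` has no effect. -/
lemma dproj_fsmul_qvol {n : ℕ} {L : Vec (2 * n + 1) → ℝ} (hL : Differentiable ℝ L)
    (x : Vec (2 * n + 1)) (v : Fin (n + 1) → Vec (2 * n + 1)) (a : Fin (n + 1)) (μ : Fin n)
    (ha : v a = basisVec (pIdx μ)) :
    dproj (fsmul L qvol) x v = exd (fsmul L qvol) x v := by
  change exd (fsmul L qvol) x v -
    wedge contact (iprod (chi (n := n)) (exd (fsmul L qvol))) x
      (fun i => v (Fin.cast (Nat.add_comm 1 n) i)) = _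
  rw [sub_eq_self]
  unfold wedge
  refine mul_eq_zero_of_right _ (Finset.sum_eq_zero fun σ _ => ?_)
  obtain ⟨b, hb⟩ : ∃ b, Fin.cast (Nat.add_comm 1 n) (σ b) = a :=
    ⟨σ.symm (Fin.cast (Nat.add_comm 1 n).symm a), by simp⟩
  induction b using Fin.addCases with
  | left i =>
    obtain rfl : i = 0 := Subsingleton.elim _ _
    refine mul_eq_zero_of_left (mul_eq_zero_of_right _ ?_) _
    simp only [contact, hb, ha, basisVec_pIdx_qIdx, basisVec_pIdx_uIdx]
    simp
  | right j =>
    refine mul_eq_zero_of_right _ ?_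
    refine exd_fsmul_qvol_eq_zero hL x _ (a := 0) (b := j.succ) (Fin.succ_ne_zero j).symm ?_ ?_
    · intro ν
      simpa using chi_qIdx ν
    · intro ν
      simp only [Fin.cons_succ, hb, ha, basisVec_pIdx_qIdx]

lemma botOp_dproj_fsmul_qvol {n : ℕ} {L : Vec (2 * (n + 1) + 1) → ℝ} (hL : Differentiable ℝ L)
    (x : Vec (2 * (n + 1) + 1)) (v : Fin n → Vec (2 * (n + 1) + 1)) :
    botOp (dproj (fsmul L qvol)) x v =
      -∑ μ : Fin (n + 1), pd (pIdx μ) L x *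
        qvol x (Fin.cons (basisVec (qIdx μ)) v : Fin (n + 1) → _) := by
  simp only [botOp, Finset.sum_apply, ← Finset.sum_neg_distrib]
  refine Finset.sum_congr rfl fun μ _ => ?_
  change dproj (fsmul L qvol) x
    (Fin.cons (basisVec (qIdx μ)) (Fin.cons (basisVec (pIdx μ)) v : Fin (n + 1) → _)) = _
  rw [dproj_fsmul_qvol hL x _ 1 μ rfl, exd_fsmul_qvol hL, Finset.sum_eq_single 1]
  · simp only [Fin.val_one, pow_one, neg_mul, one_mul, neg_inj]
    congr 2
    ext i
    cases i using Fin.cases <;> simp [Fin.succAbove]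
  · intro i _ hi
    obtain ⟨j, hj⟩ := Fin.exists_succAbove_eq hi.symm
    rw [qvol_eq_zero _ _ j]
    · simp
    · intro ν
      rw [hj]
      exact basisVec_pIdx_qIdx μ ν
  · simp

lemma jet_qIdx {n : ℕ} (φ : Vec n → ℝ) (x : Vec n) (μ : Fin n) : jet φ x (qIdx μ) = x μ := by
  simp [jet, qIdx]

lemma jet_uIdx {n : ℕ} (φ : Vec n → ℝ) (x : Vec n) : jet φ x uIdx = φ x := by
  simp [jet, uIdx]

lemma jet_pIdx {n : ℕ} (φ : Vec n → ℝ) (x : Vec n) (μ : Fin n) :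
    jet φ x (pIdx μ) = fderiv ℝ φ x (basisVec μ) := by
  simp [jet, pIdx, show ¬ n + 1 + (μ : ℕ) < n by omega, show ¬ n + 1 + (μ : ℕ) = n by omega]

lemma differentiable_jet {n : ℕ} {φ : Vec n → ℝ} (hφ : ContDiff ℝ (⊤ : ℕ∞) φ) :
    Differentiable ℝ (jet φ) := by
  refine differentiable_pi.mpr fun i => ?_
  unfold jet
  split_ifs
  · fun_prop
  · exact hφ.differentiable (by simp)
  · have : Differentiable ℝ (fderiv ℝ φ) :=
      (hφ.fderiv_right (m := 1) (by norm_cast)).differentiable (by simp)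
    exact this.clm_apply (differentiable_const _)

lemma fderiv_jet_apply {n : ℕ} {φ : Vec n → ℝ} (hφ : ContDiff ℝ (⊤ : ℕ∞) φ) (x v : Vec n)
    (i : Fin (2 * n + 1)) : fderiv ℝ (jet φ) x v i = fderiv ℝ (fun y => jet φ y i) x v := by
  rw [(hasFDerivAt_pi'.mp (differentiable_jet hφ x).hasFDerivAt i).fderiv]
  rfl

lemma fderiv_jet_qIdx {n : ℕ} {φ : Vec n → ℝ} (hφ : ContDiff ℝ (⊤ : ℕ∞) φ) (x v : Vec n)
    (μ : Fin n) : fderiv ℝ (jet φ) x v (qIdx μ) = v μ := by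
  rw [fderiv_jet_apply hφ]
  simp only [jet_qIdx]
  rw [(hasFDerivAt_apply (𝕜 := ℝ) μ x).fderiv]
  rfl

/-- The contact form pulls back to zero along prolongations. -/
lemma contact_fderiv_jet {n : ℕ} {φ : Vec n → ℝ} (hφ : ContDiff ℝ (⊤ : ℕ∞) φ) (x : Vec n)
    (v : Fin 1 → Vec n) : contact (jet φ x) (fun i => fderiv ℝ (jet φ) x (v i)) = 0 := by
  simp only [contact, fderiv_jet_qIdx hφ, jet_pIdx]
  rw [fderiv_jet_apply hφ]
  simp only [jet_uIdx]
  have := LinearMap.pi_apply_eq_sum_univ (fderiv ℝ φ x : Vec n →ₗ[ℝ] ℝ) (v 0)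
  have e : ∀ i : Fin n, (fun j => if i = j then (1 : ℝ) else 0) = basisVec i := by
    intro i
    ext j
    simp [basisVec, Pi.single_apply, eq_comm]
  simp only [e, smul_eq_mul, ContinuousLinearMap.coe_coe] at this
  rw [this, sub_eq_zero]
  exact Finset.sum_congr rfl fun _ _ => mul_comm _ _

lemma pullback_jet_proj {n k : ℕ} {φ : Vec n → ℝ} (hφ : ContDiff ℝ (⊤ : ℕ∞) φ)
    (α : Form (2 * n + 1) k) : pullback (jet φ) (proj α) = pullback (jet φ) α := by
  cases k with
  | zero => rfl
  | succ k =>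
    ext x v
    simp only [pullback, proj, Pi.sub_apply, sub_eq_self, reindex, wedge]
    refine mul_eq_zero_of_right _ (Finset.sum_eq_zero fun σ _ => ?_)
    exact mul_eq_zero_of_left (mul_eq_zero_of_right _ (contact_fderiv_jet hφ x _)) _

lemma qvol_fderiv_jet {n : ℕ} {φ : Vec n → ℝ} (hφ : ContDiff ℝ (⊤ : ℕ∞) φ) (x : Vec n)
    (v : Fin n → Vec n) : qvol (jet φ x) (fun i => fderiv ℝ (jet φ) x (v i)) = baseVol x v := by
  simp only [qvol, baseVol, fderiv_jet_qIdx hφ]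

lemma pullback_jet_lieChi {n : ℕ} {L : Vec (2 * n + 1) → ℝ} (hL : Differentiable ℝ L)
    {φ : Vec n → ℝ} (hφ : ContDiff ℝ (⊤ : ℕ∞) φ) (x : Vec n) (v : Fin n → Vec n) :
    pullback (jet φ) (lieChi (fsmul L qvol)) x v = pd uIdx L (jet φ x) * baseVol x v := by
  rw [← qvol_fderiv_jet hφ]
  simp only [pullback, lieChi]
  set w := fun i => fderiv ℝ (jet φ) x (v i)
  have : (fun y => fsmul L qvol y w) = fun y => L y * qvol (jet φ x) w := rfl
  rw [this, fderiv_mul_const (hL _)]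
  simp [mul_comm, pd, chi]

lemma pullback_jet_dproj_botOp {n : ℕ} {L : Vec (2 * (n + 1) + 1) → ℝ}
    (hL : ContDiff ℝ (⊤ : ℕ∞) L) {φ : Vec (n + 1) → ℝ} (hφ : ContDiff ℝ (⊤ : ℕ∞) φ)
    (x : Vec (n + 1)) (v : Fin (n + 1) → Vec (n + 1)) :
    pullback (jet φ) (dproj (botOp (dproj (fsmul L qvol)))) x v =
      -(∑ μ : Fin (n + 1), fderiv ℝ (fun y => pd (pIdx μ) L (jet φ y)) x (basisVec μ)) *
        baseVol x v := by
  have hL' : Differentiable ℝ L := hL.differentiable (by simp)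
  have hpd : ∀ i, Differentiable ℝ (pd i L) := fun i =>
    ((hL.fderiv_right (m := 1) (by norm_cast)).differentiable (by simp)).clm_apply
      (differentiable_const _)
  rw [dproj, pullback_jet_proj hφ]
  change ∑ i : Fin (n + 1), (-1 : ℝ) ^ (i : ℕ) *
    fderiv ℝ (fun y => botOp (dproj (fsmul L qvol)) y
      fun j : Fin n => fderiv ℝ (jet φ) x (v (i.succAbove j))) (jet φ x)
      (fderiv ℝ (jet φ) x (v i)) = _
  have hq : ∀ (y : Vec (2 * (n + 1) + 1)) (i μ : Fin (n + 1)),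
      qvol y (Fin.cons (basisVec (qIdx μ))
        (fun j : Fin n => fderiv ℝ (jet φ) x (v (i.succAbove j))) : Fin (n + 1) → _) =
      Matrix.det (Matrix.of
        (Fin.cons (basisVec μ) (fun j => v (i.succAbove j)) : Fin (n + 1) → _)) := by
    intro y i μ
    unfold qvol
    congr 1
    ext a b
    cases a using Fin.cases
    · simp [basisVec_qIdx_qIdx]
    · simp [fderiv_jet_qIdx hφ]
  have hcomp : ∀ (μ : Fin (n + 1)) (w : Vec (n + 1)),
      fderiv ℝ (pd (pIdx μ) L) (jet φ x) (fderiv ℝ (jet φ) x w) =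
        fderiv ℝ (fun y => pd (pIdx μ) L (jet φ y)) x w := by
    intro μ w
    have := fderiv_comp x (hpd (pIdx μ) (jet φ x)) (differentiable_jet hφ x)
    exact (DFunLike.congr_fun this w).symm
  simp only [botOp_dproj_fsmul_qvol hL', hq]
  have hterm : ∀ (d : Fin (n + 1) → ℝ) (y w : Vec (2 * (n + 1) + 1)),
      fderiv ℝ (fun y => -∑ μ : Fin (n + 1), pd (pIdx μ) L y * d μ) y w =
        -∑ μ : Fin (n + 1), fderiv ℝ (pd (pIdx μ) L) y w * d μ := by
    intro d y w
    have : HasFDerivAt (fun y => -∑ μ : Fin (n + 1), pd (pIdx μ) L y * d μ)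
        (-∑ μ : Fin (n + 1), d μ • fderiv ℝ (pd (pIdx μ) L) y) y :=
      (HasFDerivAt.fun_sum fun μ _ => (hpd (pIdx μ) y).hasFDerivAt.mul_const (d μ)).fun_neg
    rw [this.fderiv]
    simp [mul_comm]
  rw [Finset.sum_congr rfl fun (i : Fin (n + 1)) _ => congrArg ((-1 : ℝ) ^ (i : ℕ) * ·) (hterm
    (fun μ => Matrix.det (Matrix.of
      (Fin.cons (basisVec μ) (fun j => v (i.succAbove j)) : Fin (n + 1) → _))) _ _)]
  simp only [hcomp, mul_neg, Finset.sum_neg_distrib, neg_mul, Finset.mul_sum,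
    Finset.sum_mul]
  rw [Finset.sum_comm]
  congr 1
  exact Finset.sum_congr rfl fun μ _ => sum_mul_det_cons
    (fderiv ℝ (fun y => pd (pIdx μ) L (jet φ y)) x : Vec (n + 1) →ₗ[ℝ] ℝ) (basisVec μ) v

lemma pullback_jet_euler {n : ℕ} {L : Vec (2 * n + 1) → ℝ} (hL : ContDiff ℝ (⊤ : ℕ∞) L)
    {φ : Vec n → ℝ} (hφ : ContDiff ℝ (⊤ : ℕ∞) φ) :
    pullback (jet φ) (euler (fsmul L qvol)) =
      fsmul (fun x => pd (uIdx (n := n)) L (jet φ x) -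
        ∑ μ : Fin n, fderiv ℝ (fun y => pd (pIdx μ) L (jet φ y)) x (basisVec μ)) baseVol := by
  have hL' : Differentiable ℝ L := hL.differentiable (by simp)
  ext x v
  cases n with
  | zero =>
    refine (pullback_jet_lieChi hL' hφ x v).trans ?_
    simp [fsmul]
  | succ n =>
    refine (congrArg₂ (· + ·) (pullback_jet_dproj_botOp hL hφ x v)
      (pullback_jet_lieChi hL' hφ x v)).trans ?_
    simp only [fsmul]
    ring

lemma fsmul_baseVol_eq_zero_iff {n : ℕ} (f : Vec n → ℝ) :
    fsmul f baseVol = 0 ↔ ∀ x, f x = 0 := by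
  refine ⟨fun h x => ?_, fun h => ?_⟩
  · have h1 : baseVol x basisVec = 1 := by
      have : (Matrix.of fun i j : Fin n => (basisVec i : Vec n) j) = 1 := by
        ext i j
        simp [basisVec, Matrix.one_apply, Pi.single_apply, eq_comm]
      rw [baseVol, this, Matrix.det_one]
    simpa [fsmul, h1] using congrFun (congrFun h x) basisVec
  · ext x v
    simp [fsmul, h x]

/-- the pullback of `E(Lβ)` along `j¹φ` is the Euler–Lagrange expression of
the first-order Lagrangian `L`; in particular `Δ_{E(Lβ)}φ = 0` iff `φ` satisfies the
Euler–Lagrange equation of `L`. -/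
theorem euler_operator_gives_euler_lagrange (n : ℕ)
    (L : Vec (2 * n + 1) → ℝ) (hL : ContDiff ℝ (⊤ : ℕ∞) L)
    (φ : Vec n → ℝ) (hφ : ContDiff ℝ (⊤ : ℕ∞) φ) :
    pullback (jet φ) (euler (fsmul L qvol)) =
      fsmul (fun x => pd (uIdx (n := n)) L (jet φ x) -
        ∑ μ : Fin n, fderiv ℝ (fun y => pd (pIdx μ) L (jet φ y)) x (basisVec μ)) baseVol ∧
    (pullback (jet φ) (euler (fsmul L qvol)) = 0 ↔
      ∀ x : Vec n, pd (uIdx (n := n)) L (jet φ x) -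
        ∑ μ : Fin n, fderiv ℝ (fun y => pd (pIdx μ) L (jet φ y)) x (basisVec μ) = 0) := by
  refine ⟨pullback_jet_euler hL hφ, ?_⟩
  rw [pullback_jet_euler hL hφ]
  exact fsmul_baseVol_eq_zero_iff _

end MA
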